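/- Let A be an n×n real symmetric positive semidefinite matrix, b, δ, b' reals with δ > 0, b' = b − δ, b' ≥ δ, assume every nonzero eigenvalue of A is greater than b, and let L be an n×n real matrix with Tr[Lᵀ(A − bI)⁻¹L] ≤ −n − 2‖L‖²/δ. Then ‖L‖² · Tr[Lᵀ(A − b'I)⁻²L] ≤ (δ/2) · Tr[Lᵀ(A − b'I)⁻²L] · (−n − Tr[Lᵀ(A − b'I)⁻¹L]). -/

import Mathlib

open Matrix

/-- The resolvent of a Hermitian matrix is diagonal in an eigenbasis. -/
lemma Matrix.IsHermitian.inv_sub_smul_one {n : ℕ} {A : Matrix (Fin n) (Fin n) ℝ}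
    (hA : A.IsHermitian) {c : ℝ} (hc : ∀ i, hA.eigenvalues i - c ≠ 0) :
    (A - c • 1)⁻¹ = (hA.eigenvectorUnitary : Matrix (Fin n) (Fin n) ℝ) *
      diagonal (fun i => (hA.eigenvalues i - c)⁻¹) *
        (hA.eigenvectorUnitary : Matrix (Fin n) (Fin n) ℝ)ᴴ := by
  set U := (hA.eigenvectorUnitary : Matrix (Fin n) (Fin n) ℝ)
  have hUU : Uᴴ * U = 1 := Unitary.coe_star_mul_self hA.eigenvectorUnitary
  have hUU' : U * Uᴴ = 1 := Unitary.coe_mul_star_self hA.eigenvectorUnitary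
  have hspec : A = U * diagonal hA.eigenvalues * Uᴴ := by
    simpa [Unitary.conjStarAlgAut_apply, star_eq_conjTranspose, Function.comp_def]
      using hA.spectral_theorem
  have hshift : A - c • 1 = U * diagonal (fun i => hA.eigenvalues i - c) * Uᴴ := by
    have hdiag : diagonal (fun i => hA.eigenvalues i - c) =
        diagonal hA.eigenvalues - c • (1 : Matrix (Fin n) (Fin n) ℝ) := by
      rw [smul_one_eq_diagonal, diagonal_sub]
    rw [hdiag, mul_sub, sub_mul, ← hspec, mul_smul_comm, mul_one, smul_mul_assoc, hUU']
  apply inv_eq_right_inv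
  calc (A - c • 1) * (U * diagonal (fun i => (hA.eigenvalues i - c)⁻¹) * Uᴴ)
      = U * diagonal (fun i => hA.eigenvalues i - c) * (Uᴴ * U) *
          diagonal (fun i => (hA.eigenvalues i - c)⁻¹) * Uᴴ := by
        rw [hshift]; simp only [Matrix.mul_assoc]
    _ = 1 := by
        rw [hUU, mul_one, Matrix.mul_assoc U, diagonal_mul_diagonal]
        simp only [mul_inv_cancel₀ (hc _), diagonal_one, mul_one, hUU']

/-- The resolvent `(A - c)⁻¹` is monotone in `c` as `c` moves within a gap of the spectrum. -/
lemma Matrix.IsHermitian.posSemidef_inv_sub_inv {n : ℕ} {A : Matrix (Fin n) (Fin n) ℝ}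
    (hA : A.IsHermitian) {c d : ℝ} (hcd : c ≤ d)
    (hgap : ∀ i, hA.eigenvalues i < c ∨ d < hA.eigenvalues i) :
    ((A - d • 1)⁻¹ - (A - c • 1)⁻¹).PosSemidef := by
  have hc : ∀ i, hA.eigenvalues i - c ≠ 0 := fun i => by
    rcases hgap i with h | h
    · exact (by linarith : hA.eigenvalues i - c < 0).ne
    · exact (by linarith : 0 < hA.eigenvalues i - c).ne'
  have hd : ∀ i, hA.eigenvalues i - d ≠ 0 := fun i => by
    rcases hgap i with h | h
    · exact (by linarith : hA.eigenvalues i - d < 0).ne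
    · exact (by linarith : 0 < hA.eigenvalues i - d).ne'
  rw [hA.inv_sub_smul_one hc, hA.inv_sub_smul_one hd, ← sub_mul, ← mul_sub, diagonal_sub]
  refine PosSemidef.mul_mul_conjTranspose_same (PosSemidef.diagonal fun i => ?_) _
  rw [Pi.zero_apply, sub_nonneg]
  rcases hgap i with h | h
  · exact (inv_le_inv_of_neg (by linarith) (by linarith)).2 (by linarith)
  · exact inv_anti₀ (by linarith) (by linarith)

/-- the intermediate inequality in Step 3. -/
theorem step_three_intermediate
    (n : ℕ) (A : Matrix (Fin n) (Fin n) ℝ) (hA : A.PosSemidef)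
    (b δ b' : ℝ) (hδ : 0 < δ) (hb' : b' = b - δ) (hδb' : δ ≤ b')
    (heig : ∀ i : Fin n, hA.isHermitian.eigenvalues i ≠ 0 → b < hA.isHermitian.eigenvalues i)
    (L : Matrix (Fin n) (Fin n) ℝ)
    (htr : (Lᵀ * (A - b • 1)⁻¹ * L).trace ≤
      -(n : ℝ) - 2 * ‖Matrix.toEuclideanCLM (𝕜 := ℝ) L‖ ^ 2 / δ) :
    ‖Matrix.toEuclideanCLM (𝕜 := ℝ) L‖ ^ 2 *
        (Lᵀ * ((A - b' • 1)⁻¹ * (A - b' • 1)⁻¹) * L).trace ≤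
      (δ / 2) * (Lᵀ * ((A - b' • 1)⁻¹ * (A - b' • 1)⁻¹) * L).trace *
        (-(n : ℝ) - (Lᵀ * (A - b' • 1)⁻¹ * L).trace) := by
  have hsq : 0 ≤ (Lᵀ * ((A - b' • 1)⁻¹ * (A - b' • 1)⁻¹) * L).trace := by
    have hsymm : ((A - b' • 1)⁻¹)ᵀ = (A - b' • 1)⁻¹ := by
      have hAt : Aᵀ = A := by simpa using hA.isHermitian.eq
      rw [transpose_nonsing_inv, transpose_sub, hAt, transpose_smul, transpose_one]
    have h := (posSemidef_conjTranspose_mul_self ((A - b' • 1)⁻¹ * L)).trace_nonneg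
    rw [conjTranspose_eq_transpose_of_trivial, transpose_mul, hsymm] at h
    simpa only [Matrix.mul_assoc] using h
  have hmono : (Lᵀ * (A - b' • 1)⁻¹ * L).trace ≤ (Lᵀ * (A - b • 1)⁻¹ * L).trace := by
    have hgap : ∀ i, hA.isHermitian.eigenvalues i < b' ∨ b < hA.isHermitian.eigenvalues i := by
      intro i
      by_cases h : hA.isHermitian.eigenvalues i = 0
      · exact Or.inl (by linarith)
      · exact Or.inr (heig i h)
    have h := ((hA.isHermitian.posSemidef_inv_sub_inv (by linarith)
      hgap).conjTranspose_mul_mul_same L).trace_nonneg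
    rw [conjTranspose_eq_transpose_of_trivial, mul_sub, sub_mul, trace_sub] at h
    linarith
  have hnorm : ‖Matrix.toEuclideanCLM (𝕜 := ℝ) L‖ ^ 2 ≤
      (δ / 2) * (-(n : ℝ) - (Lᵀ * (A - b' • 1)⁻¹ * L).trace) := by
    have h : 2 * ‖Matrix.toEuclideanCLM (𝕜 := ℝ) L‖ ^ 2 / δ ≤
        -(n : ℝ) - (Lᵀ * (A - b' • 1)⁻¹ * L).trace := by linarith
    rw [div_le_iff₀ hδ] at h
    linarith
  calc _ ≤ _ := mul_le_mul_of_nonneg_right hnorm hsq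
    _ = _ := by ring
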